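/- Let 1 ≤ p < ∞ and let ℓ_p denote the real sequence space of all real sequences x with Σ|x_i|^p < ∞, normed by ‖x‖_p = (Σ|x_i|^p)^{1/p}. Then S_P(ℓ_p) ≥ 1 − 2^{−|2/p − 1|}. -/

import Mathlib

/-- The P-angle constant `S_P(X)`. -/
noncomputable def SP (X : Type*) [NormedAddCommGroup X] [NormedSpace ℝ X] : ℝ :=
  sSup {r : ℝ | ∃ x y : X, ‖x‖ = 1 ∧ ‖y‖ = 1 ∧ x ≠ y ∧ x ≠ -y ∧
    r = (‖x + y‖ ^ 2 + ‖x - y‖ ^ 2 - 4) / (2 * ‖x + y‖ * ‖x - y‖)}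

theorem bddAbove_pAngle (X : Type*) [NormedAddCommGroup X] [NormedSpace ℝ X] :
    BddAbove {r : ℝ | ∃ x y : X, ‖x‖ = 1 ∧ ‖y‖ = 1 ∧ x ≠ y ∧ x ≠ -y ∧
      r = (‖x + y‖ ^ 2 + ‖x - y‖ ^ 2 - 4) / (2 * ‖x + y‖ * ‖x - y‖)} := by
  refine ⟨1, ?_⟩
  rintro r ⟨x, y, -, hy, hne, hne', rfl⟩
  have ha : 0 < ‖x + y‖ := norm_pos_iff.2 fun h => hne' (eq_neg_of_add_eq_zero_left h)
  have hb : 0 < ‖x - y‖ := norm_pos_iff.2 (sub_ne_zero.2 hne)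
  have hd : |‖x + y‖ - ‖x - y‖| ≤ 2 := by
    refine (abs_norm_sub_norm_le _ _).trans ?_
    rw [add_sub_sub_cancel]
    exact (norm_add_le y y).trans (by linarith)
  rw [div_le_one (by positivity)]
  nlinarith [abs_le.1 hd]

theorem one_sub_le_SP {X : Type*} [NormedAddCommGroup X] [NormedSpace ℝ X] {x y : X} {a : ℝ}
    (ha : 0 < a) (hx : ‖x‖ = 1) (hy : ‖y‖ = 1) (hadd : ‖x + y‖ = a) (hsub : ‖x - y‖ = a) :
    1 - 2 / a ^ 2 ≤ SP X := by
  refine le_csSup (bddAbove_pAngle X) ⟨x, y, hx, hy, ?_, ?_, ?_⟩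
  · rintro rfl
    simp only [sub_self, norm_zero] at hsub
    exact ha.ne hsub
  · rintro rfl
    simp only [neg_add_cancel, norm_zero] at hadd
    exact ha.ne hadd
  · rw [hadd, hsub]
    field_simp
    ring

theorem lp_norm_single_add_single (p : ENNReal) [Fact (1 ≤ p)] (hp' : p ≠ ⊤) (s t : ℝ) :
    ‖lp.single (E := fun _ : ℕ => ℝ) p 0 s + lp.single p 1 t‖
      = (|s| ^ p.toReal + |t| ^ p.toReal) ^ (1 / p.toReal) := by
  have hp : 0 < p.toReal :=
    ENNReal.toReal_pos (zero_lt_one.trans_le (Fact.out : 1 ≤ p)).ne' hp'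
  have h := lp.norm_sum_single (E := fun _ : ℕ => ℝ) hp (fun i => if i = 0 then s else t)
    (Finset.range 2)
  simp only [Finset.sum_range_succ, Finset.sum_range_zero, zero_add, if_true, one_ne_zero,
    if_false, Real.norm_eq_abs] at h
  rw [← h, one_div, Real.rpow_rpow_inv (norm_nonneg _) hp.ne']

theorem stmt_2 (p : ENNReal) [Fact (1 ≤ p)] (hp' : p ≠ ⊤) :
    SP (lp (fun _ : ℕ => ℝ) p) ≥ 1 - (2 : ℝ) ^ (-|2 / p.toReal - 1|) := by
  have hp : 0 < p.toReal :=
    ENNReal.toReal_pos (zero_lt_one.trans_le (Fact.out : 1 ≤ p)).ne' hp'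
  have key := lp_norm_single_add_single p hp'
  have two_div : ∀ u : ℝ, 2 / ((2 : ℝ) ^ u) ^ 2 = 2 ^ (1 - 2 * u) := fun u => by
    rw [Real.rpow_sub two_pos, Real.rpow_one, mul_comm, Real.rpow_mul zero_le_two,
      Real.rpow_two]
  rcases le_total p.toReal 2 with h2 | h2
  · have habs : |2 / p.toReal - 1| = 2 / p.toReal - 1 :=
      abs_of_nonneg (by rw [sub_nonneg, le_div_iff₀ hp]; linarith)
    have h := one_sub_le_SP (X := lp (fun _ : ℕ => ℝ) p) (x := lp.single p 0 1)
      (y := lp.single p 1 1) (a := 2 ^ (1 / p.toReal)) (by positivity)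
      (by simpa [hp.ne'] using key 1 0) (by simpa [hp.ne'] using key 0 1)
      (by simpa [one_add_one_eq_two] using key 1 1)
      (by simpa [one_add_one_eq_two, sub_eq_add_neg] using key 1 (-1))
    rw [two_div] at h
    rw [habs]
    convert h using 3
    ring
  · have habs : |2 / p.toReal - 1| = 1 - 2 / p.toReal := by
      rw [abs_of_nonpos (by rw [sub_nonpos, div_le_iff₀ hp]; linarith)]
      ring
    obtain ⟨c, hc⟩ : ∃ c : ℝ, c = 2 ^ (-(1 / p.toReal)) := ⟨_, rfl⟩
    have hc0 : 0 < c := hc ▸ by positivity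
    have hcp : c ^ p.toReal = 1 / 2 := by
      rw [hc, ← Real.rpow_mul zero_le_two, neg_mul, one_div_mul_cancel hp.ne', Real.rpow_neg_one,
        one_div]
    have hcc : c + c = 2 ^ (1 - 1 / p.toReal) := by
      rw [sub_eq_add_neg, Real.rpow_add two_pos, Real.rpow_one, ← hc, two_mul]
    have hnorm : ∀ t : ℝ, |t| = c →
        ‖lp.single (E := fun _ : ℕ => ℝ) p 0 c + lp.single p 1 t‖ = 1 := fun t ht => by
      rw [key, ht, abs_of_pos hc0, hcp, add_halves, Real.one_rpow]
    have hadd : lp.single (E := fun _ : ℕ => ℝ) p 0 c + lp.single p 1 c +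
        (lp.single p 0 c + lp.single p 1 (-c)) =
        lp.single p 0 (c + c) + lp.single p 1 0 := by
      rw [add_add_add_comm, ← lp.single_add, ← lp.single_add, add_neg_cancel]
    have hsub : lp.single (E := fun _ : ℕ => ℝ) p 0 c + lp.single p 1 c -
        (lp.single p 0 c + lp.single p 1 (-c)) =
        lp.single p 0 0 + lp.single p 1 (c + c) := by
      rw [add_sub_add_comm, ← lp.single_sub, ← lp.single_sub, sub_self, sub_neg_eq_add]
    have h := one_sub_le_SP (a := c + c) (by positivity) (hnorm c (abs_of_pos hc0))
      (hnorm (-c) (by rw [abs_neg, abs_of_pos hc0]))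
      (by rw [hadd, key, abs_zero, Real.zero_rpow hp.ne', add_zero, one_div,
            Real.rpow_rpow_inv (abs_nonneg _) hp.ne', abs_of_pos (by positivity)])
      (by rw [hsub, key, abs_zero, Real.zero_rpow hp.ne', zero_add, one_div,
            Real.rpow_rpow_inv (abs_nonneg _) hp.ne', abs_of_pos (by positivity)])
    rw [hcc, two_div] at h
    rw [habs]
    convert h using 3
    ring
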